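/- arXiv:1807.01071 — 3 statements merged into one kernel-verified Lean document; each statement's English description precedes it below -/
import Mathlib

section
/- Fix positive reals d (antenna spacing), λw (wavelength) and γ, and set φ = 2πγd/λw. For each M ≥ 1, let θ_k(M) and θ_ℓ(M) be real angles with sin(θ_ℓ(M)) − sin(θ_k(M)) = γ/M, and let h̄_k(M) = h̄_M(θ_k(M)) and h̄_ℓ(M) = h̄_M(θ_ℓ(M)) be the corresponding ULA steering vectors in ℂ^M. Then lim_{M→∞} (1/M²)·|h̄_ℓ(M)^H h̄_k(M)|² = (λw/(2πγd))² · |e^{iφ} − 1|². -/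
open Finset Filter Real

/-- The ULA steering vector in `ℂ^M` for angle `θ`, antenna spacing `d` and
wavelength `lw`: its `m`-th entry is `exp(−i·(2πd/lw)·m·sin θ)` for `m = 0, …, M−1`. -/
noncomputable def steering (d lw : ℝ) (M : ℕ) (θ : ℝ) : Fin M → ℂ :=
  fun m => Complex.exp (-Complex.I * (2 * π * d / lw) * (m : ℕ) * Real.sin θ)

/-- The first-order behaviour of `exp` at the origin, along the sequence `z / M`. -/
lemma tendsto_natCast_mul_exp_div_sub_one (z : ℂ) :
    Tendsto (fun M : ℕ => (M : ℂ) * (Complex.exp (z / M) - 1)) atTop (nhds z) := by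
  have hderiv : HasDerivAt (fun t : ℂ => Complex.exp (z * t)) z 0 := by
    simpa using ((hasDerivAt_id (0 : ℂ)).const_mul z).cexp
  have hinv : Tendsto (fun M : ℕ => (M : ℂ)⁻¹) atTop (nhdsWithin 0 {0}ᶜ) := by
    refine tendsto_nhdsWithin_iff.2 ⟨tendsto_inv_atTop_nhds_zero_nat, ?_⟩
    filter_upwards [eventually_ge_atTop 1] with M hM
    have : M ≠ 0 := by omega
    simpa using this
  simpa [Function.comp_def, div_eq_mul_inv] using hderiv.tendsto_slope_zero.comp hinv

/-- The normalized geometric sum of the powers of `exp (z / M)` converges. -/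
lemma tendsto_natCast_inv_mul_geom_sum_exp {z : ℂ} (hz : z ≠ 0) :
    Tendsto (fun M : ℕ => (M : ℂ)⁻¹ * ∑ m ∈ range M, Complex.exp (z / M) ^ m) atTop
      (nhds (z⁻¹ * (Complex.exp z - 1))) := by
  have hlim := tendsto_natCast_mul_exp_div_sub_one z
  refine ((hlim.inv₀ hz).mul_const (Complex.exp z - 1)).congr' ?_
  filter_upwards [hlim.eventually_ne hz] with M hM
  have hM0 : (M : ℂ) ≠ 0 := left_ne_zero_of_mul hM
  have hsub : Complex.exp (z / M) - 1 ≠ 0 := right_ne_zero_of_mul hM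
  have hpow : Complex.exp (z / M) ^ M = Complex.exp z := by
    rw [← Complex.exp_nat_mul, mul_div_cancel₀ _ hM0]
  rw [geom_sum_eq (sub_ne_zero.1 hsub), hpow]
  field_simp

/-- The product of conjugate steering entries is a pure phase in the difference of sines. -/
lemma star_steering_mul_steering (d lw : ℝ) (M : ℕ) (θ₁ θ₂ : ℝ) (m : Fin M) :
    star (steering d lw M θ₁ m) * steering d lw M θ₂ m =
      Complex.exp (Complex.I *
        ((2 * π * d / lw * (Real.sin θ₁ - Real.sin θ₂) : ℝ) : ℂ)) ^ (m : ℕ) := by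
  simp only [steering, Complex.star_def]
  rw [← Complex.exp_conj, ← Complex.exp_add, ← Complex.exp_nat_mul]
  simp only [map_mul, map_div₀, map_neg, Complex.conj_I, Complex.conj_ofReal,
    Complex.conj_natCast, map_ofNat]
  congr 1
  push_cast
  ring

/-- Fix positive reals `d` (antenna spacing), `lw` (wavelength) and `γ`,
and set `φ = 2πγd/lw`.  For each `M ≥ 1`, let `θk M` and `θl M` be real angles with
`sin (θl M) − sin (θk M) = γ/M`, and let `h̄k M` and `h̄l M` be the corresponding ULA
steering vectors in `ℂ^M`.  Then
`lim_{M→∞} (1/M²)·|h̄l Mᴴ h̄k M|² = (lw/(2πγd))² · |e^{iφ} − 1|²`. -/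
theorem stmt9 (d lw γ : ℝ) (hd : 0 < d) (hlw : 0 < lw) (hγ : 0 < γ)
    (φ : ℝ) (hφ : φ = 2 * π * γ * d / lw)
    (θk θl : ℕ → ℝ)
    (hangle : ∀ M : ℕ, 1 ≤ M → Real.sin (θl M) - Real.sin (θk M) = γ / M) :
    Tendsto
      (fun M : ℕ => (1 / (M : ℝ) ^ 2) *
        ‖∑ m : Fin M, star (steering d lw M (θl M) m) * steering d lw M (θk M) m‖ ^ 2)
      atTop
      (nhds ((lw / (2 * π * γ * d)) ^ 2 * ‖Complex.exp (Complex.I * φ) - 1‖ ^ 2)) := by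
  have hφ0 : φ ≠ 0 := by rw [hφ]; positivity
  have hz : Complex.I * (φ : ℂ) ≠ 0 := by simpa using hφ0
  have hconst : (lw / (2 * π * γ * d)) ^ 2 * ‖Complex.exp (Complex.I * φ) - 1‖ ^ 2 =
      ‖(Complex.I * (φ : ℂ))⁻¹ * (Complex.exp (Complex.I * φ) - 1)‖ ^ 2 := by
    have hinv : lw / (2 * π * γ * d) = φ⁻¹ := by rw [hφ, inv_div]
    rw [hinv, norm_mul, mul_pow]
    simp
  rw [hconst]
  refine ((tendsto_natCast_inv_mul_geom_sum_exp hz).norm.pow 2).congr' ?_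
  filter_upwards [eventually_ge_atTop 1] with M hM
  have hphase : Complex.I *
      ((2 * π * d / lw * (Real.sin (θl M) - Real.sin (θk M)) : ℝ) : ℂ) =
        Complex.I * φ / M := by
    rw [hangle M hM, hφ]
    push_cast
    ring
  simp only [star_steering_mul_steering, hphase]
  rw [Fin.sum_univ_eq_sum_range (fun m => Complex.exp (Complex.I * φ / M) ^ m), norm_mul, mul_pow]
  simp
end

section
/- Let (Ω, F, P) be a probability space. Let K_k, K_ℓ ≥ 0, let h̄_k, h̄_ℓ ∈ ℂ^M be deterministic vectors, let R_k, R_ℓ be M×M complex Hermitian positive semidefinite matrices with Hermitian positive semidefinite square roots R_k^{1/2}, R_ℓ^{1/2}, and let z_k, z_ℓ : Ω → ℂ^M be independent random vectors each with E[(z)_i] = 0 and E[(z)_i · conj((z)_j)] = δ_{ij} (all relevant moments finite). Define g_k = √(K_k/(K_k+1))·h̄_k + √(1/(K_k+1))·R_k^{1/2} z_k and g_ℓ = √(K_ℓ/(K_ℓ+1))·h̄_ℓ + √(1/(K_ℓ+1))·R_ℓ^{1/2} z_ℓ. Then E[|g_k^H g_ℓ|²] = (K_ℓ/(K_ℓ+1))·(1/(K_k+1))·(h̄_ℓ^H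 R_k h̄_ℓ) + tr(R_ℓ R_k)/((K_k+1)(K_ℓ+1)) + (K_k/(K_k+1))·(K_ℓ/(K_ℓ+1))·|h̄_ℓ^H h̄_k|² + (K_k/(K_k+1))·(1/(K_ℓ+1))·(h̄_k^H R_ℓ h̄_k). -/
open Matrix Finset MeasureTheory ProbabilityTheory
open scoped ComplexOrder

/-- The Ricean channel vector `g = √(K/(K+1))·h̄ + √(1/(K+1))·R^{1/2} z`, where
`S = R^{1/2}` is the positive semidefinite square root of the covariance matrix. -/
noncomputable def ricean {M : ℕ} (K : ℝ) (hbar : Fin M → ℂ)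
    (S : Matrix (Fin M) (Fin M) ℂ) (zv : Fin M → ℂ) : Fin M → ℂ :=
  fun i => (Real.sqrt (K / (K + 1)) : ℂ) * hbar i +
    (Real.sqrt (1 / (K + 1)) : ℂ) * (S *ᵥ zv) i

lemma ricean_apply {M : ℕ} (K : ℝ) (h : Fin M → ℂ) (S : Matrix (Fin M) (Fin M) ℂ)
    (z : Fin M → ℂ) (i : Fin M) :
    ricean K h S z i = (Real.sqrt (K / (K + 1)) : ℂ) * h i +
      (Real.sqrt (1 / (K + 1)) : ℂ) * ∑ m, S i m * z m := rfl

lemma measurable_ricean {M : ℕ} (K : ℝ) (h : Fin M → ℂ) (S : Matrix (Fin M) (Fin M) ℂ) :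
    Measurable (ricean K h S) := by
  refine measurable_pi_lambda _ fun i => ?_
  simp only [ricean_apply]
  fun_prop

lemma ricean_mul_star {M : ℕ} (K : ℝ) (hK : 0 ≤ K) (h : Fin M → ℂ)
    (S : Matrix (Fin M) (Fin M) ℂ) (z : Fin M → ℂ) (i j : Fin M) :
    ricean K h S z i * star (ricean K h S z j) =
      ((K / (K + 1) : ℝ) : ℂ) * (h i * star (h j)) +
      ((1 / (K + 1) : ℝ) : ℂ) * (∑ m, ∑ n, S i m * star (S j n) * (z m * star (z n))) +
      (Real.sqrt (K / (K + 1)) : ℂ) * (Real.sqrt (1 / (K + 1)) : ℂ) *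
        (h i * star (∑ n, S j n * z n) + (∑ m, S i m * z m) * star (h j)) := by
  have ha : ((K / (K + 1) : ℝ) : ℂ) =
      (Real.sqrt (K / (K + 1)) : ℂ) * (Real.sqrt (K / (K + 1)) : ℂ) := by
    rw [← Complex.ofReal_mul, Real.mul_self_sqrt (by positivity)]
  have hb : ((1 / (K + 1) : ℝ) : ℂ) =
      (Real.sqrt (1 / (K + 1)) : ℂ) * (Real.sqrt (1 / (K + 1)) : ℂ) := by
    rw [← Complex.ofReal_mul, Real.mul_self_sqrt (by positivity)]
  have hs : ∑ m, ∑ n, S i m * star (S j n) * (z m * star (z n)) =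
      (∑ m, S i m * z m) * star (∑ n, S j n * z n) := by
    rw [star_sum, Finset.sum_mul_sum]
    refine Finset.sum_congr rfl fun m _ => Finset.sum_congr rfl fun n _ => ?_
    rw [star_mul']
    ring
  have hc (x : ℝ) : star (x : ℂ) = x := Complex.conj_ofReal x
  rw [hs, ha, hb, ricean_apply, ricean_apply, star_add, star_mul', star_mul', hc, hc]
  ring

/-- The entries of the second-moment matrix of a Ricean channel vector. -/
lemma ricean_second_moment {Ω : Type*} [MeasurableSpace Ω] (P : Measure Ω)
    [IsProbabilityMeasure P] {M : ℕ} (K : ℝ) (hK : 0 ≤ K) (h : Fin M → ℂ)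
    (R S : Matrix (Fin M) (Fin M) ℂ) (hS : S.IsHermitian) (hSR : S * S = R)
    (z : Ω → Fin M → ℂ)
    (hint1 : ∀ i, Integrable (fun ω => z ω i) P)
    (hint2 : ∀ i j, Integrable (fun ω => z ω i * star (z ω j)) P)
    (hmean : ∀ i, ∫ ω, z ω i ∂P = 0)
    (hcov : ∀ i j, ∫ ω, z ω i * star (z ω j) ∂P = if i = j then 1 else 0) (i j : Fin M) :
    Integrable (fun ω => ricean K h S (z ω) i * star (ricean K h S (z ω) j)) P ∧
    ∫ ω, ricean K h S (z ω) i * star (ricean K h S (z ω) j) ∂P =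
      ((K / (K + 1) : ℝ) : ℂ) * (h i * star (h j)) + ((1 / (K + 1) : ℝ) : ℂ) * R i j := by
  simp only [ricean_mul_star K hK]
  have hlin (i : Fin M) : Integrable (fun ω => ∑ m, S i m * z ω m) P :=
    integrable_finsetSum _ fun m _ => (hint1 m).const_mul _
  have hlin0 (i : Fin M) : ∫ ω, ∑ m, S i m * z ω m ∂P = 0 := by
    rw [integral_finsetSum _ fun m _ => (hint1 m).const_mul _]
    simp [integral_const_mul, hmean]
  have hstar (i : Fin M) : Integrable (fun ω => star (∑ m, S i m * z ω m)) P :=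
    Complex.conjCLE.toContinuousLinearMap.integrable_comp (hlin i)
  have hstar0 (i : Fin M) : ∫ ω, star (∑ m, S i m * z ω m) ∂P = 0 := by
    have := integral_conj (μ := P) (f := fun ω => ∑ m, S i m * z ω m)
    rw [hlin0, map_zero] at this
    exact this
  have hq (m n : Fin M) :
      Integrable (fun ω => S i m * star (S j n) * (z ω m * star (z ω n))) P :=
    (hint2 m n).const_mul _
  have hquad : Integrable
      (fun ω => ∑ m, ∑ n, S i m * star (S j n) * (z ω m * star (z ω n))) P :=
    integrable_finsetSum _ fun m _ => integrable_finsetSum _ fun n _ => hq m n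
  have hquad0 : ∫ ω, ∑ m, ∑ n, S i m * star (S j n) * (z ω m * star (z ω n)) ∂P = R i j := by
    rw [integral_finsetSum _ fun m _ => integrable_finsetSum _ fun n _ => hq m n]
    simp_rw [integral_finsetSum _ fun n _ => hq _ n, integral_const_mul, hcov]
    simp only [mul_ite, mul_one, mul_zero, Finset.sum_ite_eq, Finset.mem_univ, if_true]
    rw [← hSR, Matrix.mul_apply]
    exact Finset.sum_congr rfl fun m _ => by rw [hS.apply]
  have hcross := ((hstar j).const_mul (h i)).add ((hlin i).mul_const (star (h j)))
  have hc := integrable_const (μ := P) (((K / (K + 1) : ℝ) : ℂ) * (h i * star (h j)))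
  have h12 := hc.add (hquad.const_mul ((1 / (K + 1) : ℝ) : ℂ))
  have h3 := hcross.const_mul
    ((Real.sqrt (K / (K + 1)) : ℂ) * (Real.sqrt (1 / (K + 1)) : ℂ))
  refine ⟨h12.add h3, ?_⟩
  refine (integral_add h12 h3).trans ?_
  have e1 := integral_add hc (hquad.const_mul ((1 / (K + 1) : ℝ) : ℂ))
  have e2 := integral_add ((hstar j).const_mul (h i)) ((hlin i).mul_const (star (h j)))
  simp only [integral_const_mul, integral_mul_const, hquad0, hstar0, hlin0, integral_const,
    probReal_univ, one_smul, mul_zero, zero_mul, add_zero] at e1 e2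
  rw [integral_const_mul]
  refine (congrArg₂ (fun x y => x + _ * y) e1 e2).trans ?_
  simp

/-- The mean squared modulus of the inner product of two independent random vectors, in terms of
their second moments. -/
lemma integral_norm_inner_sq_of_indepFun {Ω : Type*} [MeasurableSpace Ω] (P : Measure Ω)
    {M : ℕ} (x y : Ω → Fin M → ℂ) (hxy : IndepFun x y P)
    (hx : ∀ i j, Integrable (fun ω => x ω i * star (x ω j)) P)
    (hy : ∀ i j, Integrable (fun ω => y ω i * star (y ω j)) P) :
    ((∫ ω, ‖∑ i, star (x ω i) * y ω i‖ ^ 2 ∂P : ℝ) : ℂ) =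
      ∑ i, ∑ j, (∫ ω, x ω j * star (x ω i) ∂P) * ∫ ω, y ω i * star (y ω j) ∂P := by
  have hmeas (i j : Fin M) : Measurable fun v : Fin M → ℂ => v i * star (v j) := by fun_prop
  have hind (i j : Fin M) :
      IndepFun (fun ω => x ω j * star (x ω i)) (fun ω => y ω i * star (y ω j)) P :=
    hxy.comp (hmeas j i) (hmeas i j)
  have hint (i j : Fin M) :
      Integrable (fun ω => (x ω j * star (x ω i)) * (y ω i * star (y ω j))) P :=
    (hind i j).integrable_mul (hx j i) (hy i j)
  have hexp (ω : Ω) : ((‖∑ i, star (x ω i) * y ω i‖ ^ 2 : ℝ) : ℂ) =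
      ∑ i, ∑ j, (x ω j * star (x ω i)) * (y ω i * star (y ω j)) := by
    rw [Complex.ofReal_pow, ← Complex.mul_conj', map_sum, Finset.sum_mul_sum]
    refine Finset.sum_congr rfl fun i _ => Finset.sum_congr rfl fun j _ => ?_
    simp only [map_mul, Complex.star_def, Complex.conj_conj]
    ring
  rw [← integral_complex_ofReal]
  simp_rw [hexp]
  rw [integral_finsetSum _ fun i _ => integrable_finsetSum _ fun j _ => hint i j]
  refine Finset.sum_congr rfl fun i _ => ?_
  rw [integral_finsetSum _ fun j _ => hint i j]
  refine Finset.sum_congr rfl fun j _ => ?_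
  exact (hind i j).integral_fun_mul_eq_mul_integral (hx j i).aestronglyMeasurable
    (hy i j).aestronglyMeasurable

/-- the mean interference power formula (equation (2) of the paper).
For the Ricean channels `g_k = √(Kk/(Kk+1))·h̄k + √(1/(Kk+1))·Rk^{1/2} z_k` and
`g_ℓ = √(Kℓ/(Kℓ+1))·h̄ℓ + √(1/(Kℓ+1))·Rℓ^{1/2} z_ℓ`, with `z_k, z_ℓ` independent,
zero-mean, identity-covariance random vectors,
`E[|g_kᴴ g_ℓ|²] = (Kℓ/(Kℓ+1))·(1/(Kk+1))·(h̄ℓᴴ Rk h̄ℓ) + tr(Rℓ Rk)/((Kk+1)(Kℓ+1))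
  + (Kk/(Kk+1))·(Kℓ/(Kℓ+1))·|h̄ℓᴴ h̄k|² + (Kk/(Kk+1))·(1/(Kℓ+1))·(h̄kᴴ Rℓ h̄k)`. -/
theorem stmt15 {Ω : Type*} [MeasurableSpace Ω] (P : Measure Ω) [IsProbabilityMeasure P]
    {M : ℕ} (Kk Kl : ℝ) (hKk : 0 ≤ Kk) (hKl : 0 ≤ Kl)
    (hbk hbl : Fin M → ℂ)
    (Rk Rl Sk Sl : Matrix (Fin M) (Fin M) ℂ)
    (hRk : Rk.PosSemidef) (hRl : Rl.PosSemidef)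
    (hSk : Sk.PosSemidef) (hSl : Sl.PosSemidef)
    (hSk2 : Sk * Sk = Rk) (hSl2 : Sl * Sl = Rl)
    (zk zl : Ω → Fin M → ℂ)
    (hindep : IndepFun zk zl P)
    (hzkint1 : ∀ i, Integrable (fun ω => zk ω i) P)
    (hzkint2 : ∀ i j, Integrable (fun ω => zk ω i * star (zk ω j)) P)
    (hzlint1 : ∀ i, Integrable (fun ω => zl ω i) P)
    (hzlint2 : ∀ i j, Integrable (fun ω => zl ω i * star (zl ω j)) P)
    (hzkmean : ∀ i, ∫ ω, zk ω i ∂P = 0)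
    (hzkcov : ∀ i j, ∫ ω, zk ω i * star (zk ω j) ∂P = if i = j then 1 else 0)
    (hzlmean : ∀ i, ∫ ω, zl ω i ∂P = 0)
    (hzlcov : ∀ i j, ∫ ω, zl ω i * star (zl ω j) ∂P = if i = j then 1 else 0) :
    ∫ ω, ‖∑ i, star (ricean Kk hbk Sk (zk ω) i) * ricean Kl hbl Sl (zl ω) i‖ ^ 2 ∂P
      = (Kl / (Kl + 1)) * (1 / (Kk + 1)) *
          (∑ i, ∑ j, star (hbl i) * Rk i j * hbl j).re
        + ((Rl * Rk).trace).re / ((Kk + 1) * (Kl + 1))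
        + (Kk / (Kk + 1)) * (Kl / (Kl + 1)) * ‖∑ i, star (hbl i) * hbk i‖ ^ 2
        + (Kk / (Kk + 1)) * (1 / (Kl + 1)) *
            (∑ i, ∑ j, star (hbk i) * Rl i j * hbk j).re := by
  have mk := ricean_second_moment P Kk hKk hbk Rk Sk hSk.isHermitian hSk2 zk hzkint1 hzkint2
    hzkmean hzkcov
  have ml := ricean_second_moment P Kl hKl hbl Rl Sl hSl.isHermitian hSl2 zl hzlint1 hzlint2
    hzlmean hzlcov
  have key := integral_norm_inner_sq_of_indepFun P (fun ω => ricean Kk hbk Sk (zk ω))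
    (fun ω => ricean Kl hbl Sl (zl ω))
    (hindep.comp (measurable_ricean Kk hbk Sk) (measurable_ricean Kl hbl Sl))
    (fun i j => (mk i j).1) (fun i j => (ml i j).1)
  simp only [(mk _ _).2, (ml _ _).2] at key
  have hnorm : ((‖∑ i, star (hbl i) * hbk i‖ ^ 2 : ℝ) : ℂ) =
      ∑ i, ∑ j, (hbk j * star (hbk i)) * (hbl i * star (hbl j)) := by
    rw [Complex.ofReal_pow, ← Complex.conj_mul', map_sum, Finset.sum_mul_sum]
    refine Finset.sum_congr rfl fun i _ => Finset.sum_congr rfl fun j _ => ?_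
    simp only [map_mul, Complex.star_def, Complex.conj_conj]
    ring
  have hsum : ∑ i, ∑ j,
      (((Kk / (Kk + 1) : ℝ) : ℂ) * (hbk j * star (hbk i)) + ((1 / (Kk + 1) : ℝ) : ℂ) * Rk j i) *
      (((Kl / (Kl + 1) : ℝ) : ℂ) * (hbl i * star (hbl j)) + ((1 / (Kl + 1) : ℝ) : ℂ) * Rl i j) =
      ((Kl / (Kl + 1) * (1 / (Kk + 1)) : ℝ) : ℂ) * (∑ i, ∑ j, star (hbl i) * Rk i j * hbl j) +
      ((1 / ((Kk + 1) * (Kl + 1)) : ℝ) : ℂ) * (Rl * Rk).trace +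
      ((Kk / (Kk + 1) * (Kl / (Kl + 1)) : ℝ) : ℂ) *
        ((‖∑ i, star (hbl i) * hbk i‖ ^ 2 : ℝ) : ℂ) +
      ((Kk / (Kk + 1) * (1 / (Kl + 1)) : ℝ) : ℂ) *
        (∑ i, ∑ j, star (hbk i) * Rl i j * hbk j) := by
    rw [hnorm, Finset.sum_comm (f := fun i j => star (hbl i) * Rk i j * hbl j),
      ← one_div_mul_one_div]
    simp only [Matrix.trace, Matrix.diag_apply, Matrix.mul_apply, Finset.mul_sum,
      ← Finset.sum_add_distrib]
    refine Finset.sum_congr rfl fun i _ => Finset.sum_congr rfl fun j _ => ?_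
    simp only [Complex.ofReal_mul]
    ring
  have hre := congrArg Complex.re (key.trans hsum)
  simp only [Complex.add_re, Complex.re_ofReal_mul, Complex.ofReal_re] at hre
  rw [hre]
  ring
end

section
/- For each M ≥ 1, let K_k, K_ℓ ≥ 0 be fixed, let h̄_k(M), h̄_ℓ(M) ∈ ℂ^M be deterministic vectors with ‖h̄_k(M)‖² = ‖h̄_ℓ(M)‖² = M, let R_k(M), R_ℓ(M) be M×M complex Hermitian positive semidefinite matrices with Hermitian positive semidefinite square roots, and let z_k(M), z_ℓ(M) be independent random vectors on a probability space, each with zero mean and identity covariance (E[(z)_i · conj((z)_j)] = δ_{ij}, all relevant moments finite). Define g_k(M) = √(K_k/(K_k+1))·h̄_k(M) + √(1/(K_k+1))·R_k(M)^{1/2} z_k(M) and similarly g_ℓ(M). Assume condition C1: (1/M²)·(h̄_ℓ(M)^H R_k(M) h̄_ℓ(M)) → 0 and (1/M²)·(h̄_k(M)^H R_ℓ(M) h̄_k(M)) → 0 as M → ∞; and condition C2: (1/M²)·tr(R_ℓ(M) R_k(M)) → 0 as M → ∞. Then E[ |(1/M)·g_k(M)^H g_ℓ(M) − (1/M)·E[g_k(M)^H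 g_ℓ(M)]|² ] → 0 as M → ∞; that is, the normalized off-diagonal Gram matrix entry converges in mean square to its mean. -/
open Matrix Finset MeasureTheory ProbabilityTheory Filter
open scoped ComplexOrder

/-- The second moment of a linear combination of an uncorrelated family of unit second moment. -/
theorem integral_norm_sq_sum_mul_of_uncorrelated {Ω ι : Type*} [MeasurableSpace Ω] {μ : Measure Ω}
    [Fintype ι] [DecidableEq ι] {w : Ω → ι → ℂ}
    (hint : ∀ i j, Integrable (fun ω => w ω i * star (w ω j)) μ)
    (hcov : ∀ i j, ∫ ω, w ω i * star (w ω j) ∂μ = if i = j then 1 else 0) (c : ι → ℂ) :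
    Integrable (fun ω => ‖∑ i, c i * w ω i‖ ^ 2) μ ∧
      ∫ ω, ‖∑ i, c i * w ω i‖ ^ 2 ∂μ = ∑ i, ‖c i‖ ^ 2 := by
  have expand : ∀ ω, ((‖∑ i, c i * w ω i‖ ^ 2 : ℝ) : ℂ) =
      ∑ i, ∑ j, c i * star (c j) * (w ω i * star (w ω j)) := by
    intro ω
    rw [Complex.ofReal_pow, ← Complex.mul_conj', map_sum, Finset.sum_mul_sum]
    refine Finset.sum_congr rfl fun i _ => Finset.sum_congr rfl fun j _ => ?_
    simp only [map_mul, Complex.star_def]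
    ring
  have hF : Integrable (fun ω => ((‖∑ i, c i * w ω i‖ ^ 2 : ℝ) : ℂ)) μ := by
    simp only [expand]
    exact integrable_finsetSum _ fun i _ => integrable_finsetSum _ fun j _ =>
      (hint i j).const_mul _
  refine ⟨hF.re, ?_⟩
  apply Complex.ofReal_injective
  rw [← integral_complex_ofReal]
  simp only [expand]
  rw [integral_finsetSum _ fun i _ => integrable_finsetSum _ fun j _ => (hint i j).const_mul _]
  push_cast
  refine Finset.sum_congr rfl fun i _ => ?_
  rw [integral_finsetSum _ fun j _ => (hint i j).const_mul _]
  simp only [integral_const_mul, hcov, mul_ite, mul_one, mul_zero, Finset.sum_ite_eq,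
    Finset.mem_univ, if_true]
  exact Complex.mul_conj' _

theorem Matrix.IsHermitian.sum_norm_sq_star_vecMul {n : Type*} [Fintype n]
    {S : Matrix n n ℂ} (hS : S.IsHermitian) (h : n → ℂ) :
    ∑ j, ‖(star h ᵥ* S) j‖ ^ 2 = (∑ i, ∑ j, star (h i) * (S * S) i j * h j).re := by
  apply Complex.ofReal_injective
  have h1 : (((∑ j, ‖(star h ᵥ* S) j‖ ^ 2 : ℝ)) : ℂ) = star h ⬝ᵥ ((S * S) *ᵥ h) := by
    rw [← mulVec_mulVec, dotProduct_mulVec]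
    have h2 : S *ᵥ h = star (star h ᵥ* S) := by rw [star_vecMul, star_star, hS.eq]
    rw [h2]
    simp [dotProduct, Complex.mul_conj']
  have h3 : star h ⬝ᵥ ((S * S) *ᵥ h) = ∑ i, ∑ j, star (h i) * (S * S) i j * h j := by
    simp [dotProduct, mulVec, Finset.mul_sum, mul_assoc]
  rw [← h3, ← h1, Complex.ofReal_re]

theorem Matrix.IsHermitian.sum_norm_sq_mul {n : Type*} [Fintype n]
    {S T : Matrix n n ℂ} (hS : S.IsHermitian) (hT : T.IsHermitian) :
    ∑ p : n × n, ‖(S * T) p.1 p.2‖ ^ 2 = ((T * T * (S * S)).trace).re := by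
  have h1 : ((∑ p : n × n, ‖(S * T) p.1 p.2‖ ^ 2 : ℝ) : ℂ) = (S * T * (S * T)ᴴ).trace := by
    rw [Fintype.sum_prod_type]
    simp only [Matrix.trace, diag_apply, Matrix.mul_apply (M := S * T), conjTranspose_apply,
      Complex.star_def, Complex.mul_conj']
    push_cast
    rfl
  have h2 : (S * T * (S * T)ᴴ).trace = (T * T * (S * S)).trace := by
    rw [conjTranspose_mul, hS.eq, hT.eq, Matrix.mul_assoc, Matrix.trace_mul_comm]
    simp only [Matrix.mul_assoc]
  rw [← h2, ← h1, Complex.ofReal_re]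

theorem star_ricean_dotProduct_ricean {M : ℕ} (K K' : ℝ) (h h' : Fin M → ℂ)
    {S T : Matrix (Fin M) (Fin M) ℂ} (hS : S.IsHermitian) (z z' : Fin M → ℂ) :
    ∑ i, star (ricean K h S z i) * ricean K' h' T z' i =
      (√(K / (K + 1)) * √(K' / (K' + 1)) : ℂ) * (star h ⬝ᵥ h') +
      ((√(K / (K + 1)) * √(1 / (K' + 1)) : ℂ) * ∑ j, (star h ᵥ* T) j * z' j +
      (√(1 / (K + 1)) * √(K' / (K' + 1)) : ℂ) * ∑ j, star (star h' ᵥ* S) j * star (z j) +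
      (√(1 / (K + 1)) * √(1 / (K' + 1)) : ℂ) *
        ∑ p : Fin M × Fin M, (S * T) p.1 p.2 * (star (z p.1) * z' p.2)) := by
  have h1 : ∑ j, (star h ᵥ* T) j * z' j = star h ⬝ᵥ (T *ᵥ z') := (dotProduct_mulVec _ _ _).symm
  have h2 : ∑ j, star (star h' ᵥ* S) j * star (z j) = star (S *ᵥ z) ⬝ᵥ h' := by
    rw [star_mulVec, hS.eq, ← dotProduct_mulVec, star_vecMul, star_star, hS.eq, dotProduct_comm]
    rfl
  have h3 : ∑ p : Fin M × Fin M, (S * T) p.1 p.2 * (star (z p.1) * z' p.2) =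
      star (S *ᵥ z) ⬝ᵥ (T *ᵥ z') := by
    rw [star_mulVec, hS.eq, ← dotProduct_mulVec, mulVec_mulVec, Fintype.sum_prod_type]
    simp only [dotProduct, mulVec, Finset.mul_sum, Pi.star_apply]
    exact Finset.sum_congr rfl fun i _ => Finset.sum_congr rfl fun j _ => by ring
  rw [h1, h2, h3]
  simp only [dotProduct, Finset.mul_sum, ← Finset.sum_add_distrib]
  refine Finset.sum_congr rfl fun i _ => ?_
  simp only [ricean, Pi.star_apply, star_add, star_mul', Complex.star_def, Complex.conj_ofReal]
  ring

theorem norm_add_add_sq_le {E : Type*} [SeminormedAddCommGroup E] (x y z : E) :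
    ‖x + y + z‖ ^ 2 ≤ 3 * (‖x‖ ^ 2 + ‖y‖ ^ 2 + ‖z‖ ^ 2) := by
  have h := pow_le_pow_left₀ (norm_nonneg _) (norm_add₃_le (a := x) (b := y) (c := z)) 2
  nlinarith [sq_nonneg (‖x‖ - ‖y‖), sq_nonneg (‖y‖ - ‖z‖), sq_nonneg (‖x‖ - ‖z‖)]

theorem norm_sqrt_mul_sqrt_mul_sq_le {a b : ℝ} (ha : a ≤ 1) (hb : b ≤ 1) (x : ℂ) :
    ‖(√a * √b : ℂ) * x‖ ^ 2 ≤ ‖x‖ ^ 2 := by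
  have ha' : √a ≤ 1 := Real.sqrt_le_one.2 ha
  have hb' : √b ≤ 1 := Real.sqrt_le_one.2 hb
  rw [norm_mul, norm_mul, Complex.norm_real, Complex.norm_real,
    Real.norm_of_nonneg (Real.sqrt_nonneg _), Real.norm_of_nonneg (Real.sqrt_nonneg _)]
  gcongr
  exact mul_le_of_le_one_left (norm_nonneg _) (mul_le_one₀ ha' (Real.sqrt_nonneg _) hb')

theorem integral_const_add_of_centered {Ω : Type*} [MeasurableSpace Ω] {μ : Measure Ω}
    [IsProbabilityMeasure μ] {f g k : Ω → ℂ} (hf : Integrable f μ) (hg : Integrable g μ)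
    (hk : Integrable k μ) (hf0 : ∫ ω, f ω ∂μ = 0) (hg0 : ∫ ω, g ω ∂μ = 0)
    (hk0 : ∫ ω, k ω ∂μ = 0) (a b c d : ℂ) :
    ∫ ω, (d + (a * f ω + b * g ω + c * k ω)) ∂μ = d := by
  have hab : Integrable (fun ω => a * f ω + b * g ω) μ := (hf.const_mul a).add (hg.const_mul b)
  have habc : Integrable (fun ω => a * f ω + b * g ω + c * k ω) μ := hab.add (hk.const_mul c)
  rw [integral_add (integrable_const _) habc, integral_add hab (hk.const_mul c),
    integral_add (hf.const_mul a) (hg.const_mul b)]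
  simp [integral_const_mul, hf0, hg0, hk0]

/-- Quantitative bound on the variance of the inner product of two independent Ricean vectors. -/
theorem integral_norm_sq_ricean_sub_le {M : ℕ} {Ω : Type*} [MeasurableSpace Ω] {μ : Measure Ω}
    [IsProbabilityMeasure μ] {K K' : ℝ} (hK : 0 ≤ K) (hK' : 0 ≤ K') (h h' : Fin M → ℂ)
    {S T : Matrix (Fin M) (Fin M) ℂ} (hS : S.IsHermitian) (hT : T.IsHermitian)
    {z z' : Ω → Fin M → ℂ} (hindep : IndepFun z z' μ)
    (hz : ∀ i, Integrable (fun ω => z ω i) μ)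
    (hzz : ∀ i j, Integrable (fun ω => z ω i * star (z ω j)) μ)
    (hz' : ∀ i, Integrable (fun ω => z' ω i) μ)
    (hzz' : ∀ i j, Integrable (fun ω => z' ω i * star (z' ω j)) μ)
    (hmean : ∀ i, ∫ ω, z ω i ∂μ = 0)
    (hcov : ∀ i j, ∫ ω, z ω i * star (z ω j) ∂μ = if i = j then 1 else 0)
    (hmean' : ∀ i, ∫ ω, z' ω i ∂μ = 0)
    (hcov' : ∀ i j, ∫ ω, z' ω i * star (z' ω j) ∂μ = if i = j then 1 else 0) :
    ∫ ω, ‖(∑ i, star (ricean K h S (z ω) i) * ricean K' h' T (z' ω) i) -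
        ∫ ω', (∑ i, star (ricean K h S (z ω') i) * ricean K' h' T (z' ω') i) ∂μ‖ ^ 2 ∂μ ≤
      3 * ((∑ i, ∑ j, star (h i) * (T * T) i j * h j).re +
        (∑ i, ∑ j, star (h' i) * (S * S) i j * h' j).re + ((T * T * (S * S)).trace).re) := by
  have hs : ∀ i, Integrable (fun ω => star (z ω i)) μ := fun i =>
    (LinearIsometryEquiv.integrable_comp_iff Complex.conjLIE).2 (hz i)
  have hsmean : ∀ i, ∫ ω, star (z ω i) ∂μ = 0 := fun i => by
    simpa [hmean i] using integral_conj (μ := μ) (f := fun ω => z ω i)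
  have hss : ∀ i j, Integrable (fun ω => star (z ω i) * star (star (z ω j))) μ := fun i j => by
    simpa [mul_comm] using hzz j i
  have hscov : ∀ i j, ∫ ω, star (z ω i) * star (star (z ω j)) ∂μ = if i = j then 1 else 0 := by
    intro i j
    simpa [mul_comm, eq_comm] using hcov j i
  have hind1 : ∀ i j, IndepFun (fun ω => star (z ω i)) (fun ω => z' ω j) μ := fun i j =>
    hindep.comp (φ := fun v : Fin M → ℂ => star (v i)) (ψ := fun v : Fin M → ℂ => v j)
      (Continuous.measurable (by fun_prop)) (Continuous.measurable (by fun_prop))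
  have hind2 : ∀ i j i' j', IndepFun (fun ω => star (z ω i) * star (star (z ω j)))
      (fun ω => z' ω i' * star (z' ω j')) μ := fun i j i' j' =>
    hindep.comp (φ := fun v : Fin M → ℂ => star (v i) * star (star (v j)))
      (ψ := fun v : Fin M → ℂ => v i' * star (v j'))
      (Continuous.measurable (by fun_prop)) (Continuous.measurable (by fun_prop))
  have hp : ∀ p : Fin M × Fin M, Integrable (fun ω => star (z ω p.1) * z' ω p.2) μ := fun p =>
    (hind1 p.1 p.2).integrable_mul (hs p.1) (hz' p.2)
  have hpmean : ∀ p : Fin M × Fin M, ∫ ω, star (z ω p.1) * z' ω p.2 ∂μ = 0 := fun p => by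
    rw [(hind1 p.1 p.2).integral_fun_mul_eq_mul_integral (hs p.1).aestronglyMeasurable
      (hz' p.2).aestronglyMeasurable, hmean', mul_zero]
  have hsplit : ∀ p q : Fin M × Fin M, (fun ω => star (z ω p.1) * z' ω p.2 *
      star (star (z ω q.1) * z' ω q.2)) = fun ω => (star (z ω p.1) * star (star (z ω q.1))) *
        (z' ω p.2 * star (z' ω q.2)) := fun p q => by
    funext ω
    rw [star_mul']
    ring
  have hpp : ∀ p q : Fin M × Fin M, Integrable (fun ω => star (z ω p.1) * z' ω p.2 *
      star (star (z ω q.1) * z' ω q.2)) μ := fun p q => by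
    rw [hsplit]
    exact (hind2 _ _ _ _).integrable_mul (hss _ _) (hzz' _ _)
  have hpcov : ∀ p q : Fin M × Fin M, ∫ ω, star (z ω p.1) * z' ω p.2 *
      star (star (z ω q.1) * z' ω q.2) ∂μ = if p = q then 1 else 0 := fun p q => by
    rw [hsplit, (hind2 _ _ _ _).integral_fun_mul_eq_mul_integral (hss _ _).aestronglyMeasurable
      (hzz' _ _).aestronglyMeasurable, hscov, hcov']
    simp only [Prod.ext_iff, ite_and, ite_mul, one_mul, zero_mul]
  obtain ⟨i1, e1⟩ := integral_norm_sq_sum_mul_of_uncorrelated hzz' hcov' (star h ᵥ* T)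
  obtain ⟨i2, e2⟩ := integral_norm_sq_sum_mul_of_uncorrelated (w := fun ω i => star (z ω i))
    hss hscov (star (star h' ᵥ* S))
  obtain ⟨i3, e3⟩ := integral_norm_sq_sum_mul_of_uncorrelated
    (w := fun ω (p : Fin M × Fin M) => star (z ω p.1) * z' ω p.2) hpp hpcov
    (fun p => (S * T) p.1 p.2)
  have j1 : Integrable (fun ω => ∑ j, (star h ᵥ* T) j * z' ω j) μ :=
    integrable_finsetSum _ fun j _ => (hz' j).const_mul _
  have j2 : Integrable (fun ω => ∑ j, star (star h' ᵥ* S) j * star (z ω j)) μ :=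
    integrable_finsetSum _ fun j _ => (hs j).const_mul _
  have j3 : Integrable (fun ω => ∑ p : Fin M × Fin M, (S * T) p.1 p.2 *
      (star (z ω p.1) * z' ω p.2)) μ :=
    integrable_finsetSum _ fun p _ => (hp p).const_mul _
  have m1 : ∫ ω, ∑ j, (star h ᵥ* T) j * z' ω j ∂μ = 0 := by
    rw [integral_finsetSum _ fun j _ => (hz' j).const_mul _]
    simp only [integral_const_mul, hmean', mul_zero, Finset.sum_const_zero]
  have m2 : ∫ ω, ∑ j, star (star h' ᵥ* S) j * star (z ω j) ∂μ = 0 := by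
    rw [integral_finsetSum _ fun j _ => (hs j).const_mul _]
    simp only [integral_const_mul, hsmean, mul_zero, Finset.sum_const_zero]
  have m3 : ∫ ω, ∑ p : Fin M × Fin M, (S * T) p.1 p.2 * (star (z ω p.1) * z' ω p.2) ∂μ = 0 := by
    rw [integral_finsetSum _ fun p _ => (hp p).const_mul _]
    simp only [integral_const_mul, hpmean, mul_zero, Finset.sum_const_zero]
  simp only [star_ricean_dotProduct_ricean K K' h h' hS]
  rw [integral_const_add_of_centered j1 j2 j3 m1 m2 m3]
  simp only [add_sub_cancel_left]
  have i12 : Integrable (fun ω => ‖∑ j, (star h ᵥ* T) j * z' ω j‖ ^ 2 +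
      ‖∑ j, star (star h' ᵥ* S) j * star (z ω j)‖ ^ 2) μ := i1.add i2
  have hle : ∀ {a : ℝ}, 0 ≤ a → a / (a + 1) ≤ 1 := fun {a} ha =>
    div_le_one_of_le₀ (by linarith) (by linarith)
  have hle' : ∀ {a : ℝ}, 0 ≤ a → 1 / (a + 1) ≤ 1 := fun {a} ha =>
    div_le_one_of_le₀ (by linarith) (by linarith)
  calc _ ≤ ∫ ω, 3 * (‖∑ j, (star h ᵥ* T) j * z' ω j‖ ^ 2 +
          ‖∑ j, star (star h' ᵥ* S) j * star (z ω j)‖ ^ 2 +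
          ‖∑ p : Fin M × Fin M, (S * T) p.1 p.2 * (star (z ω p.1) * z' ω p.2)‖ ^ 2) ∂μ := by
        refine integral_mono_of_nonneg (ae_of_all _ fun ω => by positivity)
          ((i12.add i3).const_mul 3) (ae_of_all _ fun ω => ?_)
        refine (norm_add_add_sq_le _ _ _).trans ?_
        refine mul_le_mul_of_nonneg_left (add_le_add (add_le_add ?_ ?_) ?_) (by norm_num)
        · exact norm_sqrt_mul_sqrt_mul_sq_le (hle hK) (hle' hK') _
        · exact norm_sqrt_mul_sqrt_mul_sq_le (hle' hK) (hle hK') _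
        · exact norm_sqrt_mul_sqrt_mul_sq_le (hle' hK) (hle' hK') _
    _ = _ := by
        rw [integral_const_mul, integral_add i12 i3, integral_add i1 i2, e1, e2, e3,
          ← hT.sum_norm_sq_star_vecMul, ← hS.sum_norm_sq_star_vecMul, hS.sum_norm_sq_mul hT]
        simp only [Pi.star_apply, norm_star]

/-- off-diagonal part of Proposition 1: for Ricean channels
`g_k(M), g_ℓ(M)` with LoS vectors of squared norm `M`, PSD covariance matrices with
PSD square roots, and independent zero-mean identity-covariance diffuse components,
if condition C1 (`h̄ℓᴴ Rk h̄ℓ / M² → 0` and `h̄kᴴ Rℓ h̄k / M² → 0`) and condition C2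
(`tr(Rℓ Rk)/M² → 0`) hold, then
`E[|(1/M)·g_kᴴ g_ℓ − (1/M)·E[g_kᴴ g_ℓ]|²] → 0` as `M → ∞`:  the normalized
off-diagonal Gram matrix entry converges in mean square to its mean. -/
theorem stmt17
    (Kk Kl : ℝ) (hKk : 0 ≤ Kk) (hKl : 0 ≤ Kl)
    (Ω : ℕ → Type) (mΩ : ∀ M, MeasurableSpace (Ω M)) (P : ∀ M, Measure (Ω M))
    (hprob : ∀ M, IsProbabilityMeasure (P M))
    (hbk hbl : ∀ M : ℕ, Fin M → ℂ)
    (hbknorm : ∀ M : ℕ, ∑ i, ‖hbk M i‖ ^ 2 = (M : ℝ))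
    (hblnorm : ∀ M : ℕ, ∑ i, ‖hbl M i‖ ^ 2 = (M : ℝ))
    (Rk Rl Sk Sl : ∀ M : ℕ, Matrix (Fin M) (Fin M) ℂ)
    (hRk : ∀ M, (Rk M).PosSemidef) (hRl : ∀ M, (Rl M).PosSemidef)
    (hSk : ∀ M, (Sk M).PosSemidef) (hSl : ∀ M, (Sl M).PosSemidef)
    (hSk2 : ∀ M, Sk M * Sk M = Rk M) (hSl2 : ∀ M, Sl M * Sl M = Rl M)
    (zk zl : ∀ M : ℕ, Ω M → Fin M → ℂ)
    (hindep : ∀ M, IndepFun (zk M) (zl M) (P M))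
    (hzkint1 : ∀ M i, Integrable (fun ω => zk M ω i) (P M))
    (hzkint2 : ∀ M i j, Integrable (fun ω => zk M ω i * star (zk M ω j)) (P M))
    (hzlint1 : ∀ M i, Integrable (fun ω => zl M ω i) (P M))
    (hzlint2 : ∀ M i j, Integrable (fun ω => zl M ω i * star (zl M ω j)) (P M))
    (hzkmean : ∀ M i, ∫ ω, zk M ω i ∂(P M) = 0)
    (hzkcov : ∀ M i j, ∫ ω, zk M ω i * star (zk M ω j) ∂(P M) = if i = j then 1 else 0)
    (hzlmean : ∀ M i, ∫ ω, zl M ω i ∂(P M) = 0)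
    (hzlcov : ∀ M i j, ∫ ω, zl M ω i * star (zl M ω j) ∂(P M) = if i = j then 1 else 0)
    (hC1 : Tendsto (fun M : ℕ => (1 / (M : ℝ) ^ 2) *
        (∑ i, ∑ j, star (hbl M i) * Rk M i j * hbl M j).re) atTop (nhds 0))
    (hC1' : Tendsto (fun M : ℕ => (1 / (M : ℝ) ^ 2) *
        (∑ i, ∑ j, star (hbk M i) * Rl M i j * hbk M j).re) atTop (nhds 0))
    (hC2 : Tendsto (fun M : ℕ => (1 / (M : ℝ) ^ 2) * ((Rl M * Rk M).trace).re)
        atTop (nhds 0)) :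
    Tendsto (fun M : ℕ =>
        ∫ ω, ‖(1 / (M : ℂ)) *
            (∑ i, star (ricean Kk (hbk M) (Sk M) (zk M ω) i) *
              ricean Kl (hbl M) (Sl M) (zl M ω) i) -
          (1 / (M : ℂ)) *
            ∫ ω', (∑ i, star (ricean Kk (hbk M) (Sk M) (zk M ω') i) *
              ricean Kl (hbl M) (Sl M) (zl M ω') i) ∂(P M)‖ ^ 2 ∂(P M))
      atTop (nhds 0) := by
  have hlim := ((hC1'.add hC1).add hC2).const_mul 3
  simp only [add_zero, mul_zero] at hlim
  refine squeeze_zero (fun M => integral_nonneg fun ω => by positivity) (fun M => ?_) hlim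
  have := hprob M
  have key := integral_norm_sq_ricean_sub_le hKk hKl (hbk M) (hbl M) (hSk M).isHermitian
    (hSl M).isHermitian (hindep M) (hzkint1 M) (hzkint2 M) (hzlint1 M) (hzlint2 M) (hzkmean M)
    (hzkcov M) (hzlmean M) (hzlcov M)
  rw [hSk2, hSl2] at key
  simp only [← mul_sub, norm_mul, mul_pow, integral_const_mul]
  have hM : ‖(1 / (M : ℂ))‖ ^ 2 = 1 / (M : ℝ) ^ 2 := by simp
  rw [hM]
  exact (mul_le_mul_of_nonneg_left key (by positivity)).trans_eq (by ring)
end
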